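/- (Lemma 1) There is no real-analytic function f : ℝ → ℝ satisfying the similarity equation f'''(η) = 1 - (f'(η))² + f(η)·f''(η) for all η, together with the wall boundary conditions f(0) = 0 and f'(0) = 0, for which f' attains the stationary value 1 at some finite η₀, i.e. such that f'(η₀) = 1 and f''(η₀) = 0 for some η₀. -/

import Mathlib

/-- A nonnegative function whose derivative is bounded by a continuous multiple of the function
vanishes identically as soon as it vanishes at one point. -/
theorem eq_zero_of_abs_deriv_le_mul {E E' k : ℝ → ℝ} (hk : Continuous k)
    (hE : ∀ t, HasDerivAt E (E' t) t) (hE0 : ∀ t, 0 ≤ E t) (hb : ∀ t, |E' t| ≤ k t * E t)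
    {a : ℝ} (ha : E a = 0) (b : ℝ) : E b = 0 := by
  have hK : ∀ t, HasDerivAt (fun s => ∫ x in (0 : ℝ)..s, k x) (k t) t := fun t =>
    (hk.integral_hasStrictDerivAt 0 t).hasDerivAt
  set K : ℝ → ℝ := fun s => ∫ x in (0 : ℝ)..s, k x
  have hmono : Monotone fun t => E t * Real.exp (K t) := by
    refine monotone_of_hasDerivAt_nonneg (fun t => (hE t).mul (hK t).exp) fun t => ?_
    have : 0 ≤ (E' t + k t * E t) * Real.exp (K t) :=
      mul_nonneg (by linarith [neg_le_of_abs_le (hb t)]) (Real.exp_pos _).le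
    simp only [Pi.zero_apply]
    linarith
  have hanti : Antitone fun t => E t * Real.exp (-K t) := by
    refine antitone_of_hasDerivAt_nonpos (fun t => (hE t).mul (hK t).neg.exp) fun t => ?_
    have : 0 ≤ (k t * E t - E' t) * Real.exp (-K t) :=
      mul_nonneg (by linarith [le_of_abs_le (hb t)]) (Real.exp_pos _).le
    simp only [Pi.zero_apply, Pi.neg_apply]
    linarith
  refine le_antisymm ?_ (hE0 b)
  rcases le_total b a with h | h
  · have := hmono h
    simp only [ha, zero_mul] at this
    exact nonpos_of_mul_nonpos_left this (Real.exp_pos _)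
  · have := hanti h
    simp only [ha, zero_mul] at this
    exact nonpos_of_mul_nonpos_left this (Real.exp_pos _)

/-- Lemma 1: no real-analytic solution of `f''' = 1 - (f')² + f·f''` with the wall
boundary conditions `f(0) = 0`, `f'(0) = 0` can have `f'` attain the stationary
value `1` at a finite `η₀`. -/
theorem stmt_2 :
    ¬ ∃ (f : ℝ → ℝ) (η₀ : ℝ),
      (∀ x : ℝ, AnalyticAt ℝ f x) ∧
      (∀ η : ℝ,
        iteratedDeriv 3 f η = 1 - (deriv f η) ^ 2 + f η * iteratedDeriv 2 f η) ∧
      f 0 = 0 ∧ deriv f 0 = 0 ∧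
      deriv f η₀ = 1 ∧ iteratedDeriv 2 f η₀ = 0 := by
  rintro ⟨f, η₀, hf, hode, -, h0', h1, h2⟩
  have h2eq : iteratedDeriv 2 f = deriv (deriv f) := by
    rw [iteratedDeriv_succ, iteratedDeriv_one]
  have hd1 : ∀ t, HasDerivAt (deriv f) (iteratedDeriv 2 f t) t := fun t => by
    rw [h2eq]
    exact (hf t).deriv.differentiableAt.hasDerivAt
  have hd2 : ∀ t, HasDerivAt (iteratedDeriv 2 f) (iteratedDeriv 3 f t) t := fun t => by
    rw [iteratedDeriv_succ (n := 2), h2eq]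
    exact (hf t).deriv.deriv.differentiableAt.hasDerivAt
  have hcf : Continuous f := continuous_iff_continuousAt.2 fun t => (hf t).continuousAt
  have hcf' : Continuous (deriv f) :=
    continuous_iff_continuousAt.2 fun t => (hf t).deriv.continuousAt
  have key := eq_zero_of_abs_deriv_le_mul
    (E := fun t => (deriv f t - 1) ^ 2 + iteratedDeriv 2 f t ^ 2)
    (k := fun t => |deriv f t| + 2 * |f t|) (by fun_prop)
    (fun t => (((hd1 t).sub_const 1).pow 2).add ((hd2 t).pow 2))
    (fun t => by positivity) (fun t => ?_) (a := η₀) (by simp [h1, h2]) 0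
  · rw [h0'] at key
    nlinarith [sq_nonneg (iteratedDeriv 2 f 0)]
  · rw [hode t]
    generalize f t = u, deriv f t = v, iteratedDeriv 2 f t = w
    have hE : |2 * ((v - 1) * w)| ≤ (v - 1) ^ 2 + w ^ 2 :=
      abs_le.2 ⟨by nlinarith [sq_nonneg (v - 1 + w)], by nlinarith [sq_nonneg (v - 1 - w)]⟩
    calc _ = |2 * u * w ^ 2 - v * (2 * ((v - 1) * w))| := by
          congr 1
          push_cast
          ring
      _ ≤ |2 * u * w ^ 2| + |v * (2 * ((v - 1) * w))| := abs_sub _ _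
      _ = 2 * |u| * w ^ 2 + |v| * |2 * ((v - 1) * w)| := by
          rw [abs_mul v, abs_mul, abs_mul, abs_two, abs_of_nonneg (sq_nonneg w)]
      _ ≤ 2 * |u| * ((v - 1) ^ 2 + w ^ 2) + |v| * ((v - 1) ^ 2 + w ^ 2) := by
          gcongr
          nlinarith [sq_nonneg (v - 1)]
      _ = _ := by ring
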